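/- arXiv:2412.13285 — 4 statements merged into one kernel-verified Lean document; each statement's English description precedes it below -/
import Mathlib

section
/- Let 𝔤 be a real Lie algebra and let θ ∈ ℝ with sin θ ≠ 0. Let A_t, A_1, A_2, A_3, φ_t, φ_1, φ_2, φ_3 : ℝ⁴ → 𝔤 be smooth (coordinates (t,x¹,x²,x³)). Then the following two systems of equations are equivalent (they hold at a point for one system iff the other holds there). System H (the component form of the ℝ_s-invariant Haydys–Witten equations on ℝ_s × ℝ⁴ with distinguished vector field v = cos θ ∂_s + sin θ ∂_t, after identifying the fifth connection component Â_s with φ_t): for every cyclic triple (i,j,k): (H1) sin θ·∇_i φ_t + cos θ·F_{ti} + F_{jk} − [φ_j,φ_k] − cos θ·[φ_t,φ_i] − sin θ·∇_t φ_i = 0; (H2) sin θ·(F_{ti} − [φ_t,φ_i]) + cos θ·(∇_t φ_i − ∇_i φ_t) − (∇_j φ_k − ∇_k φ_j) = 0; together with (H0) ∇_t φ_t + Σ_{l=1}^{3} ∇_l φ_l = 0. System K (the θ-Kapustin–Witten equations in combined form, with Hodge duality conventions ε_{t123} = 1): for every cyclic triple (i,j,k): F_{ti} − [φ_t,φ_i]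 + cot θ·(d_Aφ)_{ti} − csc θ·(d_Aφ)_{jk} = 0 and F_{jk} − [φ_j,φ_k] + cot θ·(d_Aφ)_{jk} − csc θ·(d_Aφ)_{ti} = 0; together with ∇_t φ_t + Σ_{l=1}^{3} ∇_l φ_l = 0. -/
section

variable {G : Type*} [NormedAddCommGroup G] [NormedSpace ℝ G] [LieRing G] [LieAlgebra ℝ G]

/-- Partial derivative `∂_μ f` of a `𝔤`-valued field on `ℝ⁴` (index `0` is `t`). -/
noncomputable def pd (μ : Fin 4) (f : (Fin 4 → ℝ) → G) (p : Fin 4 → ℝ) : G :=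
  fderiv ℝ f p (Pi.single μ 1)

/-- Covariant derivative `∇_μ f = ∂_μ f + [A_μ, f]`. -/
noncomputable def cov (A : Fin 4 → (Fin 4 → ℝ) → G) (μ : Fin 4)
    (f : (Fin 4 → ℝ) → G) (p : Fin 4 → ℝ) : G :=
  pd μ f p + ⁅A μ p, f p⁆

/-- Curvature `F_{μν} = ∂_μ A_ν − ∂_ν A_μ + [A_μ, A_ν]`. -/
noncomputable def curv (A : Fin 4 → (Fin 4 → ℝ) → G) (μ ν : Fin 4) (p : Fin 4 → ℝ) : G :=
  pd μ (A ν) p - pd ν (A μ) p + ⁅A μ p, A ν p⁆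

/-- `(d_Aφ)_{μν} = ∇_μ φ_ν − ∇_ν φ_μ`. -/
noncomputable def dAphi (A φ : Fin 4 → (Fin 4 → ℝ) → G) (μ ν : Fin 4) (p : Fin 4 → ℝ) : G :=
  cov A μ (φ ν) p - cov A ν (φ μ) p

end

/-- `(i,j,k)` is a cyclic permutation of the spatial indices `(1,2,3)` in `Fin 4`
(index `0` being the `t`-direction). -/
def CyclicSpatial (i j k : Fin 4) : Prop :=
  (i, j, k) = (1, 2, 3) ∨ (i, j, k) = (2, 3, 1) ∨ (i, j, k) = (3, 1, 2)

/-- For `s ≠ 0` and `c² + s² = 1`, the linear system `Y + c X = s D`, `s X + c D = E` is equivalent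
to `X + (c / s) D = s⁻¹ E`, `Y + (c / s) E = s⁻¹ D`. -/
theorem rotated_pair_eq_zero_iff {K M : Type*} [Field K] [AddCommGroup M] [Module K M]
    {s c : K} (hs : s ≠ 0) (hcs : c ^ 2 + s ^ 2 = 1) (X Y D E : M) :
    (Y + c • X - s • D = 0 ∧ s • X + c • D - E = 0) ↔
      (X + (c / s) • D - s⁻¹ • E = 0 ∧ Y + (c / s) • E - s⁻¹ • D = 0) := by
  have first : X + (c / s) • D - s⁻¹ • E = s⁻¹ • (s • X + c • D - E) := by
    match_scalars <;> field_simp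
  have second : Y + (c / s) • E - s⁻¹ • D =
      (Y + c • X - s • D) - (c / s) • (s • X + c • D - E) := by
    match_scalars <;> field_simp
    · linear_combination hcs
    · ring
  rw [first, second, smul_eq_zero_iff_right (inv_ne_zero hs), and_comm]
  exact and_congr_right fun h => by rw [h, smul_zero, sub_zero]

/-- **ℝ-invariant Haydys–Witten equations = θ-Kapustin–Witten equations.**
Let `𝔤` be a real Lie algebra, `θ ∈ ℝ` with `sin θ ≠ 0`, and let
`A_t,A_1,A_2,A_3,φ_t,φ_1,φ_2,φ_3 : ℝ⁴ → 𝔤` be smooth (index `0` is `t`).  At every point,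
System H — the component form of the `ℝ_s`-invariant Haydys–Witten equations on `ℝ_s × ℝ⁴`
with `v = cos θ ∂_s + sin θ ∂_t`, after identifying `Â_s` with `φ_t` — holds iff System K —
the θ-Kapustin–Witten equations in combined form (with `ε_{t123} = 1`) — holds. -/
theorem R_invariant_HW_equals_theta_KW {G : Type*}
    [NormedAddCommGroup G] [NormedSpace ℝ G] [LieRing G] [LieAlgebra ℝ G]
    (θ : ℝ) (hθ : Real.sin θ ≠ 0)
    (A φ : Fin 4 → (Fin 4 → ℝ) → G)
    (hA : ∀ μ, ContDiff ℝ (⊤ : ℕ∞) (A μ)) (hφ : ∀ μ, ContDiff ℝ (⊤ : ℕ∞) (φ μ)) :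
    ∀ p : Fin 4 → ℝ,
      -- System H
      ((∀ i j k : Fin 4, CyclicSpatial i j k →
          (Real.sin θ • cov A i (φ 0) p + Real.cos θ • curv A 0 i p
            + curv A j k p - ⁅φ j p, φ k p⁆ - Real.cos θ • ⁅φ 0 p, φ i p⁆
            - Real.sin θ • cov A 0 (φ i) p = 0)
          ∧ (Real.sin θ • (curv A 0 i p - ⁅φ 0 p, φ i p⁆)
            + Real.cos θ • (cov A 0 (φ i) p - cov A i (φ 0) p)
            - (cov A j (φ k) p - cov A k (φ j) p) = 0))
        ∧ (cov A 0 (φ 0) p + ∑ l : Fin 3, cov A l.succ (φ l.succ) p = 0))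
      ↔
      -- System K
      ((∀ i j k : Fin 4, CyclicSpatial i j k →
          (curv A 0 i p - ⁅φ 0 p, φ i p⁆
            + (Real.cos θ / Real.sin θ) • dAphi A φ 0 i p
            - (Real.sin θ)⁻¹ • dAphi A φ j k p = 0)
          ∧ (curv A j k p - ⁅φ j p, φ k p⁆
            + (Real.cos θ / Real.sin θ) • dAphi A φ j k p
            - (Real.sin θ)⁻¹ • dAphi A φ 0 i p = 0))
        ∧ (cov A 0 (φ 0) p + ∑ l : Fin 3, cov A l.succ (φ l.succ) p = 0)) := by
  intro p
  refine and_congr_left' (forall₄_congr fun i j k _ => ?_)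
  rw [← rotated_pair_eq_zero_iff hθ (Real.cos_sq_add_sin_sq θ)]
  unfold dAphi
  refine and_congr_left' (Eq.congr_left ?_)
  module
end

section
/- Let 𝔤 be a real Lie algebra, β ∈ ℝ, and let A_y, A_s, A_1, A_2, A_3, φ_1, φ_2, φ_3 : I → 𝔤 be smooth maps on an open interval I ⊆ ℝ, with ∇_y X := dX/dy + [A_y, X]. Then the following two systems of ordinary differential equations are equivalent. System A (the ℝ⁴-invariant reduction of the Haydys–Witten equations): for i = 1,2,3: sin β·(∇_y A_i + [A_s, φ_i]) + cos β·(∇_y φ_i − [A_s, A_i]) + ½ ε_{ijk}([φ_j,φ_k] − [A_j,A_k]) = 0 and cos β·(∇_y A_i + [A_s, φ_i]) − sin β·(∇_y φ_i − [A_s, A_i]) − ε_{ijk}[A_j, φ_k] = 0; together with ∇_y A_s + Σ_i [A_i, φ_i] = 0. System B: for i = 1,2,3: ∇_y φ_i − [A_s, A_i] + ε_{ijk}( cos β·½([φ_j,φ_k] − [A_j,A_k]) + sin β·[φ_j, A_k] ) = 0 and ∇_y A_i + [A_s, φ_i] − ε_{ijk}( −sin β·½([φ_j,φ_k] − [A_j,A_k])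 + cos β·[φ_j, A_k] ) = 0; together with ∇_y A_s + Σ_i [A_i, φ_i] = 0. -/
/-- Levi-Civita sign of a tuple `a : Fin n → Fin n`. -/
def lcsign {n : ℕ} (a : Fin n → Fin n) : ℤ :=
  ∏ p : Fin n, ∏ q : Fin n,
    if p < q then (if a p < a q then 1 else if a q < a p then -1 else 0) else 1

/-- The Levi-Civita symbol `ε_{ijk}` on `Fin 3` with `ε₀₁₂ = 1`, as a real number. -/
noncomputable def eps3 (i j k : Fin 3) : ℝ := (lcsign ![i, j, k] : ℝ)

theorem eps3_swap (i j k : Fin 3) : eps3 i k j = - eps3 i j k := by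
  have h : lcsign ![i, k, j] = - lcsign ![i, j, k] := by
    revert i j k
    decide
  simp [eps3, h]

/-- The contraction `ε_{ijk} [a_j, b_k]` is symmetric in `a` and `b`. -/
theorem sum_eps3_lie_comm {L : Type*} [LieRing L] [Module ℝ L] (a b : Fin 3 → L) (i : Fin 3) :
    ∑ j : Fin 3, ∑ k : Fin 3, eps3 i j k • ⁅a j, b k⁆ =
      ∑ j : Fin 3, ∑ k : Fin 3, eps3 i j k • ⁅b j, a k⁆ := by
  rw [Finset.sum_comm]
  refine Finset.sum_congr rfl fun j _ => Finset.sum_congr rfl fun k _ => ?_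
  rw [eps3_swap, ← lie_skew, smul_neg, neg_smul, neg_neg]

/-- A rotation by `β` acting on a pair of linear equations gives an equivalent pair. -/
theorem rotate_eq_zero_iff {M : Type*} [AddCommGroup M] [Module ℝ M] (β : ℝ) (a p q s : M) :
    (Real.sin β • a + Real.cos β • p + q = 0 ∧ Real.cos β • a - Real.sin β • p - s = 0) ↔
      (p + (Real.cos β • q + Real.sin β • s) = 0 ∧
        a - ((-Real.sin β) • q + Real.cos β • s) = 0) := by
  have h := Real.sin_sq_add_cos_sq β
  constructor
  · rintro ⟨h₁, h₂⟩
    constructor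
    · linear_combination (norm := module) Real.cos β • h₁ - Real.sin β • h₂ - h • p
    · linear_combination (norm := module) Real.sin β • h₁ + Real.cos β • h₂ - h • a
  · rintro ⟨h₁, h₂⟩
    constructor
    · linear_combination (norm := module) Real.cos β • h₁ + Real.sin β • h₂ - h • q
    · linear_combination (norm := module) Real.cos β • h₂ - Real.sin β • h₁ + h • s


/-- **ℝ⁴-invariant reduction of the Haydys–Witten equations: two equivalent forms.**
Let `𝔤` be a real Lie algebra and `β ∈ ℝ`.  For smooth `𝔤`-valued fields
`A_y, A_s, A_1, A_2, A_3, φ_1, φ_2, φ_3` on an open interval `I ⊆ ℝ`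
(with `∇_y X = dX/dy + [A_y, X]`), at every point of `I` System A
(the ℝ⁴-invariant reduction of the Haydys–Witten equations) holds iff
System B (the β-twisted octonionic Nahm form) holds. -/
theorem R4_invariant_HW_equals_twisted_Nahm {G : Type*}
    [NormedAddCommGroup G] [NormedSpace ℝ G] [LieRing G] [LieAlgebra ℝ G]
    (β : ℝ) (I : Set ℝ) (hI : IsOpen I) (hI' : I.OrdConnected)
    (Ay As : ℝ → G) (A φ : Fin 3 → ℝ → G)
    (hAy : ContDiffOn ℝ (⊤ : ℕ∞) Ay I) (hAs : ContDiffOn ℝ (⊤ : ℕ∞) As I)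
    (hA : ∀ i, ContDiffOn ℝ (⊤ : ℕ∞) (A i) I) (hφ : ∀ i, ContDiffOn ℝ (⊤ : ℕ∞) (φ i) I) :
    ∀ y ∈ I,
      -- System A
      (((∀ i : Fin 3,
            Real.sin β • ((deriv (A i) y + ⁅Ay y, A i y⁆) + ⁅As y, φ i y⁆)
              + Real.cos β • ((deriv (φ i) y + ⁅Ay y, φ i y⁆) - ⁅As y, A i y⁆)
              + (2 : ℝ)⁻¹ • ∑ j : Fin 3, ∑ k : Fin 3,
                  eps3 i j k • (⁅φ j y, φ k y⁆ - ⁅A j y, A k y⁆) = 0)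
          ∧ (∀ i : Fin 3,
            Real.cos β • ((deriv (A i) y + ⁅Ay y, A i y⁆) + ⁅As y, φ i y⁆)
              - Real.sin β • ((deriv (φ i) y + ⁅Ay y, φ i y⁆) - ⁅As y, A i y⁆)
              - ∑ j : Fin 3, ∑ k : Fin 3, eps3 i j k • ⁅A j y, φ k y⁆ = 0)
          ∧ ((deriv As y + ⁅Ay y, As y⁆) + ∑ i : Fin 3, ⁅A i y, φ i y⁆ = 0))
        ↔
      -- System B
        ((∀ i : Fin 3,
            (deriv (φ i) y + ⁅Ay y, φ i y⁆) - ⁅As y, A i y⁆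
              + ∑ j : Fin 3, ∑ k : Fin 3, eps3 i j k •
                  (Real.cos β • ((2 : ℝ)⁻¹ • (⁅φ j y, φ k y⁆ - ⁅A j y, A k y⁆))
                    + Real.sin β • ⁅φ j y, A k y⁆) = 0)
          ∧ (∀ i : Fin 3,
            (deriv (A i) y + ⁅Ay y, A i y⁆) + ⁅As y, φ i y⁆
              - ∑ j : Fin 3, ∑ k : Fin 3, eps3 i j k •
                  ((- Real.sin β) • ((2 : ℝ)⁻¹ • (⁅φ j y, φ k y⁆ - ⁅A j y, A k y⁆))
                    + Real.cos β • ⁅φ j y, A k y⁆) = 0)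
          ∧ ((deriv As y + ⁅Ay y, As y⁆) + ∑ i : Fin 3, ⁅A i y, φ i y⁆ = 0))) := by
  intro y _
  rw [← and_assoc, ← and_assoc, ← forall_and, ← forall_and]
  refine and_congr_left fun _ => forall_congr' fun i => ?_
  rw [sum_eps3_lie_comm (fun j => A j y) (fun k => φ k y), rotate_eq_zero_iff]
  simp only [smul_add, Finset.sum_add_distrib, Finset.smul_sum, smul_comm (eps3 _ _ _)]
end

section
/- Let 𝔤 be a real Lie algebra, let 𝔱₁, 𝔱₂, 𝔱₃ ∈ 𝔤, and let α, β ∈ ℝ. Then for any a₁, a₂, a₃, b₁, b₂, b₃ ∈ 𝔤 the following two systems of linear equations are equivalent. System E (the indicial equations of the Haydys–Witten operator at a β-twisted Nahm pole, restricted to perturbations with vanishing components a_s = a_y = 0): for i = 1,2,3: α b_i + ε_{ijk}( cos²β·[𝔱_j, b_k] + sin β cos β·[𝔱_j, a_k] − sin β cos β·[𝔱_{τ(j)}, a_k] + sin²β·[𝔱_{τ(j)}, b_k] ) = 0 and α a_i − ε_{ijk}( cos²β·[𝔱_j, a_k] − sin β cos β·[𝔱_j, b_k] + sin β cos β·[𝔱_{τ(j)},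 b_k] + sin²β·[𝔱_{τ(j)}, a_k] ) = 0. System D (decoupled form): for i = 1,2,3: α(sin β·a_i + cos β·b_i) + ε_{ijk}( cos β·[𝔱_j, b_k] − sin β·[𝔱_{τ(j)}, a_k] ) = 0 and α(cos β·a_i − sin β·b_i) − ε_{ijk}( cos β·[𝔱_j, a_k] + sin β·[𝔱_{τ(j)}, b_k] ) = 0. -/
/-- The permutation `τ` of `{1,2,3}` with `τ(1)=1, τ(2)=3, τ(3)=2` (indices shifted to `Fin 3`). -/
def tau3 : Fin 3 → Fin 3 := ![0, 2, 1]

/-- Two pairs of vectors related by a plane rotation vanish simultaneously. -/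
theorem rotated_pair_eq_zero_iff_s3 {M : Type*} [AddCommGroup M] [Module ℝ M] {c s : ℝ}
    (h : c ^ 2 + s ^ 2 = 1) {x y u v : M} (hu : u = c • x + s • y) (hv : v = c • y - s • x) :
    (x = 0 ∧ y = 0) ↔ (u = 0 ∧ v = 0) := by
  constructor
  · rintro ⟨rfl, rfl⟩
    simp [hu, hv]
  · rintro ⟨rfl, rfl⟩
    have hx : (c ^ 2 + s ^ 2) • x = c • (c • x + s • y) - s • (c • y - s • x) := by module
    have hy : (c ^ 2 + s ^ 2) • y = s • (c • x + s • y) + c • (c • y - s • x) := by module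
    rw [h, one_smul, ← hu, ← hv] at hx hy
    simpa using And.intro hx hy

/-- **Decoupling of the indicial equations at a β-twisted Nahm pole.**
Let `𝔤` be a real Lie algebra, `𝔱₁,𝔱₂,𝔱₃ ∈ 𝔤` and `α, β ∈ ℝ`.  For all
`a₁,a₂,a₃,b₁,b₂,b₃ ∈ 𝔤`, System E (the indicial equations of the Haydys–Witten operator at a
β-twisted Nahm pole, restricted to perturbations with `a_s = a_y = 0`) is equivalent to the
decoupled System D. -/
theorem indicial_equations_decouple {G : Type*} [LieRing G] [LieAlgebra ℝ G]
    (t : Fin 3 → G) (α β : ℝ) (a b : Fin 3 → G) :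
    -- System E
    ((∀ i : Fin 3,
        α • b i + ∑ j : Fin 3, ∑ k : Fin 3, eps3 i j k •
          ((Real.cos β ^ 2) • ⁅t j, b k⁆
            + (Real.sin β * Real.cos β) • ⁅t j, a k⁆
            - (Real.sin β * Real.cos β) • ⁅t (tau3 j), a k⁆
            + (Real.sin β ^ 2) • ⁅t (tau3 j), b k⁆) = 0)
      ∧ (∀ i : Fin 3,
        α • a i - ∑ j : Fin 3, ∑ k : Fin 3, eps3 i j k •
          ((Real.cos β ^ 2) • ⁅t j, a k⁆
            - (Real.sin β * Real.cos β) • ⁅t j, b k⁆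
            + (Real.sin β * Real.cos β) • ⁅t (tau3 j), b k⁆
            + (Real.sin β ^ 2) • ⁅t (tau3 j), a k⁆) = 0))
    ↔
    -- System D
    ((∀ i : Fin 3,
        α • (Real.sin β • a i + Real.cos β • b i)
          + ∑ j : Fin 3, ∑ k : Fin 3, eps3 i j k •
              (Real.cos β • ⁅t j, b k⁆ - Real.sin β • ⁅t (tau3 j), a k⁆) = 0)
      ∧ (∀ i : Fin 3,
        α • (Real.cos β • a i - Real.sin β • b i)
          - ∑ j : Fin 3, ∑ k : Fin 3, eps3 i j k •
              (Real.cos β • ⁅t j, a k⁆ + Real.sin β • ⁅t (tau3 j), b k⁆) = 0)) := by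
  have h : Real.cos β ^ 2 + Real.sin β ^ 2 = 1 := Real.cos_sq_add_sin_sq β
  rw [← forall_and, ← forall_and]
  refine forall_congr' fun i => rotated_pair_eq_zero_iff_s3 h ?_ ?_
  all_goals
    simp only [smul_add, smul_sub, Finset.sum_add_distrib, Finset.sum_sub_distrib, smul_smul]
    simp only [mul_comm (eps3 _ _ _), mul_smul, ← Finset.smul_sum]
    generalize Real.cos β = c at *
    generalize Real.sin β = s at *
    generalize ∑ j, ∑ k, eps3 i j k • ⁅t j, a k⁆ = Ta
    generalize ∑ j, ∑ k, eps3 i j k • ⁅t j, b k⁆ = Tb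
    generalize ∑ j, ∑ k, eps3 i j k • ⁅t (tau3 j), a k⁆ = Sa
    generalize ∑ j, ∑ k, eps3 i j k • ⁅t (tau3 j), b k⁆ = Sb
  · linear_combination (norm := module) (-c * h) • Tb + (s * h) • Sa
  · linear_combination (norm := module) (c * h) • Ta + (s * h) • Sb
end

section
/- Let V be a real vector space and let ω, η : {0,1,2,3}² → V be antisymmetric arrays. Define (⋆ω)_{μν} := ½ Σ_{ρ,σ} ε_{μνρσ} ω_{ρσ} with ε_{0123} = 1, extend ⋆ complex-linearly to arrays valued in the complexification V ⊗ ℂ, set Ω := ω + i·η, and let Ω̄ := ω − i·η denote its entrywise complex conjugate. Then for every θ ∈ ℝ with sin θ ≠ 0 the following are equivalent: (a) ω + cot θ·η − csc θ·(⋆η) = 0; (b) Ω = e^{i(π−θ)} · ⋆Ω̄. -/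
open scoped TensorProduct

/-- The Levi-Civita symbol `ε_{μνρσ}` on `{0,1,2,3}` with `ε₀₁₂₃ = 1`, as a real number. -/
noncomputable def eps4 (μ ν ρ σ : Fin 4) : ℝ := (lcsign ![μ, ν, ρ, σ] : ℝ)

/-- The Hodge star `(⋆ω)_{μν} = ½ Σ_{ρσ} ε_{μνρσ} ω_{ρσ}`; since the coefficients `ε` are
real, on arrays valued in the complexification `ℂ ⊗[ℝ] V` this is the complex-linear
extension of the Hodge star on `V`-valued arrays. -/
noncomputable def hodge4 {W : Type*} [AddCommGroup W] [Module ℝ W]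
    (ω : Fin 4 → Fin 4 → W) (μ ν : Fin 4) : W :=
  (2 : ℝ)⁻¹ • ∑ ρ : Fin 4, ∑ σ : Fin 4, eps4 μ ν ρ σ • ω ρ σ

theorem sum_lcsign_mul_lcsign (μ ν α β : Fin 4) :
    ∑ ρ : Fin 4, ∑ σ : Fin 4, lcsign ![μ, ν, ρ, σ] * lcsign ![ρ, σ, α, β] =
      2 * ((if μ = α then 1 else 0) * (if ν = β then 1 else 0) -
        (if μ = β then 1 else 0) * (if ν = α then 1 else 0)) := by
  revert μ ν α β
  decide +kernel

/-- The contraction identity `Σ_{ρσ} ε_{μνρσ} ε_{ρσαβ} = 2(δ_{μα} δ_{νβ} - δ_{μβ} δ_{να})`. -/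
theorem sum_eps4_mul_eps4 (μ ν α β : Fin 4) :
    ∑ ρ : Fin 4, ∑ σ : Fin 4, eps4 μ ν ρ σ * eps4 ρ σ α β =
      2 * ((if μ = α then 1 else 0) * (if ν = β then 1 else 0) -
        (if μ = β then 1 else 0) * (if ν = α then 1 else 0)) := by
  have h := congrArg (Int.cast : ℤ → ℝ) (sum_lcsign_mul_lcsign μ ν α β)
  push_cast at h
  exact h

section Hodge

variable {W : Type*} [AddCommGroup W] [Module ℝ W]

theorem hodge4_add (ω η : Fin 4 → Fin 4 → W) : hodge4 (ω + η) = hodge4 ω + hodge4 η := by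
  funext μ ν
  simp only [hodge4, Pi.add_apply, smul_add, Finset.sum_add_distrib]

theorem hodge4_smul (c : ℝ) (ω : Fin 4 → Fin 4 → W) : hodge4 (c • ω) = c • hodge4 ω := by
  funext μ ν
  simp only [hodge4, Pi.smul_apply, smul_comm _ c, ← Finset.smul_sum]

theorem hodge4_sub (ω η : Fin 4 → Fin 4 → W) : hodge4 (ω - η) = hodge4 ω - hodge4 η := by
  funext μ ν
  simp only [hodge4, Pi.sub_apply, smul_sub, Finset.sum_sub_distrib]

theorem hodge4_map {W' : Type*} [AddCommGroup W'] [Module ℝ W'] (f : W →ₗ[ℝ] W')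
    (ω : Fin 4 → Fin 4 → W) (μ ν : Fin 4) :
    hodge4 (fun ρ σ => f (ω ρ σ)) μ ν = f (hodge4 ω μ ν) := by
  simp only [hodge4, map_smul, map_sum]

/-- The Hodge star is an involution on antisymmetric arrays. -/
theorem hodge4_hodge4 (ω : Fin 4 → Fin 4 → W) (hω : ∀ μ ν, ω μ ν = - ω ν μ) :
    hodge4 (hodge4 ω) = ω := by
  funext μ ν
  have key : ∑ ρ : Fin 4, ∑ σ : Fin 4, eps4 μ ν ρ σ •
        ∑ α : Fin 4, ∑ β : Fin 4, eps4 ρ σ α β • ω α β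
      = ∑ α : Fin 4, ∑ β : Fin 4,
          (∑ ρ : Fin 4, ∑ σ : Fin 4, eps4 μ ν ρ σ * eps4 ρ σ α β) • ω α β := by
    simp only [Finset.smul_sum, Finset.sum_smul, smul_smul]
    simpa only [Fintype.sum_prod_type] using
      Finset.sum_comm (s := Finset.univ) (t := Finset.univ)
        (f := fun p q : Fin 4 × Fin 4 =>
          (eps4 μ ν p.1 p.2 * eps4 p.1 p.2 q.1 q.2) • ω q.1 q.2)
  calc hodge4 (hodge4 ω) μ ν
      = (2 : ℝ)⁻¹ • (2 : ℝ)⁻¹ • ∑ ρ : Fin 4, ∑ σ : Fin 4, eps4 μ ν ρ σ •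
          ∑ α : Fin 4, ∑ β : Fin 4, eps4 ρ σ α β • ω α β := by
        simp only [hodge4, smul_comm (eps4 _ _ _ _) (2 : ℝ)⁻¹, ← Finset.smul_sum]
    _ = (2 : ℝ)⁻¹ • (ω μ ν - ω ν μ) := by
        rw [key]
        simp only [sum_eps4_mul_eps4, mul_smul, sub_smul, ite_smul, one_smul, zero_smul,
          Finset.sum_sub_distrib, ← Finset.smul_sum, Finset.sum_ite_irrel,
          Finset.sum_const_zero, Finset.sum_ite_eq, Finset.mem_univ, if_true]
        module
    _ = ω μ ν := by
        rw [hω ν μ]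
        module

end Hodge

/-- Real and imaginary parts in the complexification are unique. -/
theorem one_tmul_add_I_tmul_inj {V : Type*} [AddCommGroup V] [Module ℝ V] {v w v' w' : V} :
    ((1 : ℂ) ⊗ₜ[ℝ] v + Complex.I ⊗ₜ[ℝ] w : ℂ ⊗[ℝ] V) =
      (1 : ℂ) ⊗ₜ[ℝ] v' + Complex.I ⊗ₜ[ℝ] w' ↔ v = v' ∧ w = w' := by
  refine ⟨fun h => ⟨?_, ?_⟩, fun ⟨hv, hw⟩ => by rw [hv, hw]⟩
  · simpa using congrArg (TensorProduct.lid ℝ V ∘ Complex.reLm.rTensor V) h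
  · simpa using congrArg (TensorProduct.lid ℝ V ∘ Complex.imLm.rTensor V) h

theorem exp_I_mul_pi_sub (θ : ℝ) :
    Complex.exp (Complex.I * ((Real.pi - θ : ℝ) : ℂ)) =
      (-Real.cos θ : ℝ) + (Real.sin θ : ℝ) * Complex.I := by
  rw [mul_comm, Complex.exp_mul_I, ← Complex.ofReal_cos, ← Complex.ofReal_sin,
    Real.cos_pi_sub, Real.sin_pi_sub]

theorem complex_smul_one_tmul_sub_I_tmul {V : Type*} [AddCommGroup V] [Module ℝ V]
    (a b : ℝ) (v w : V) :
    ((a : ℂ) + b * Complex.I) • ((1 : ℂ) ⊗ₜ[ℝ] v - Complex.I ⊗ₜ[ℝ] w : ℂ ⊗[ℝ] V) =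
      (1 : ℂ) ⊗ₜ[ℝ] (a • v + b • w) + Complex.I ⊗ₜ[ℝ] (b • v - a • w) := by
  have h₁ : ((a : ℂ) + b * Complex.I) * 1 = a • (1 : ℂ) + b • Complex.I := by simp
  have h₂ : ((a : ℂ) + b * Complex.I) * Complex.I = a • Complex.I - b • (1 : ℂ) := by
    simp only [Complex.real_smul]
    linear_combination (b : ℂ) * Complex.I_mul_I
  rw [smul_sub, TensorProduct.smul_tmul', TensorProduct.smul_tmul', smul_eq_mul, smul_eq_mul,
    h₁, h₂]
  simp only [TensorProduct.add_tmul, TensorProduct.sub_tmul, TensorProduct.tmul_add,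
    TensorProduct.tmul_sub, TensorProduct.tmul_smul, TensorProduct.smul_tmul']
  abel

theorem hodge4_one_tmul_sub_I_tmul {V : Type*} [AddCommGroup V] [Module ℝ V]
    (ω η : Fin 4 → Fin 4 → V) (μ ν : Fin 4) :
    hodge4 (fun ρ σ => ((1 : ℂ) ⊗ₜ[ℝ] ω ρ σ - Complex.I ⊗ₜ[ℝ] η ρ σ : ℂ ⊗[ℝ] V)) μ ν =
      (1 : ℂ) ⊗ₜ[ℝ] hodge4 ω μ ν - Complex.I ⊗ₜ[ℝ] hodge4 η μ ν := by
  have h := congrFun₂ (hodge4_sub (fun ρ σ => TensorProduct.mk ℝ ℂ V 1 (ω ρ σ))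
    (fun ρ σ => TensorProduct.mk ℝ ℂ V Complex.I (η ρ σ))) μ ν
  rw [Pi.sub_apply, Pi.sub_apply, hodge4_map, hodge4_map] at h
  exact h

/-- **The combined θ-Kapustin–Witten equation as a phase-shifted conjugate
anti-self-duality equation.**
Let `V` be a real vector space, `ω, η` antisymmetric `V`-valued arrays on `{0,1,2,3}`,
`Ω := ω + i·η` and `Ω̄ := ω − i·η` valued in `ℂ ⊗[ℝ] V`.  For every `θ ∈ ℝ` with
`sin θ ≠ 0` the following are equivalent:
(a) `ω + cot θ·η − csc θ·(⋆η) = 0`;  (b) `Ω = e^{i(π−θ)}·⋆Ω̄`. -/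
theorem KW_combined_iff_phase_shifted_asd {V : Type*} [AddCommGroup V] [Module ℝ V]
    (ω η : Fin 4 → Fin 4 → V)
    (hω : ∀ μ ν, ω μ ν = - ω ν μ) (hη : ∀ μ ν, η μ ν = - η ν μ)
    (θ : ℝ) (hθ : Real.sin θ ≠ 0) :
    (∀ μ ν : Fin 4,
        ω μ ν + (Real.cos θ / Real.sin θ) • η μ ν
          - (Real.sin θ)⁻¹ • hodge4 η μ ν = 0)
    ↔ (∀ μ ν : Fin 4,
        ((1 : ℂ) ⊗ₜ[ℝ] ω μ ν + Complex.I ⊗ₜ[ℝ] η μ ν : ℂ ⊗[ℝ] V)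
          = Complex.exp (Complex.I * ((Real.pi - θ : ℝ) : ℂ)) •
              hodge4 (fun ρ σ => (1 : ℂ) ⊗ₜ[ℝ] ω ρ σ - Complex.I ⊗ₜ[ℝ] η ρ σ) μ ν) := by
  simp only [hodge4_one_tmul_sub_I_tmul, exp_I_mul_pi_sub, complex_smul_one_tmul_sub_I_tmul,
    one_tmul_add_I_tmul_inj]
  have hsq := Real.sin_sq_add_cos_sq θ
  set s := Real.sin θ
  set c := Real.cos θ
  have star_star_ω := hodge4_hodge4 ω hω
  have star_star_η := hodge4_hodge4 η hη
  constructor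
  · intro h
    have hodge_η : hodge4 η = s • ω + c • η := by
      funext μ ν
      have hs := congrArg (s • ·) (h μ ν)
      simp only [smul_sub, smul_add, smul_smul, mul_inv_cancel₀ hθ, mul_div_cancel₀ c hθ,
        one_smul, smul_zero] at hs
      exact (sub_eq_zero.mp hs).symm
    have eq_η : η = s • hodge4 ω + c • hodge4 η := by
      rw [← hodge4_smul, ← hodge4_smul, ← hodge4_add, ← hodge_η, star_star_η]
    intro μ ν
    have h₁ : hodge4 η μ ν = s • ω μ ν + c • η μ ν := congrFun₂ hodge_η μ ν
    have h₂ : η μ ν = s • hodge4 ω μ ν + c • hodge4 η μ ν := congrFun₂ eq_η μ ν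
    refine ⟨smul_right_injective V hθ ?_, ?_⟩
    · have hone : hodge4 η μ ν = (s ^ 2 + c ^ 2) • hodge4 η μ ν := by rw [hsq, one_smul]
      linear_combination (norm := module) hone - h₁ - c • h₂
    · linear_combination (norm := module) h₂
  · intro h μ ν
    have eq_η : η = s • hodge4 ω + c • hodge4 η := by
      funext μ ν
      rw [(h μ ν).2, neg_smul, sub_neg_eq_add]
      rfl
    have hodge_η : hodge4 η = s • ω + c • η := by
      conv_lhs => rw [eq_η]
      rw [hodge4_add, hodge4_smul, hodge4_smul, star_star_ω, star_star_η]
    have h₁ : hodge4 η μ ν = s • ω μ ν + c • η μ ν := congrFun₂ hodge_η μ ν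
    rw [h₁, smul_add, smul_smul, smul_smul, inv_mul_cancel₀ hθ, one_smul, div_eq_inv_mul, sub_self]
end
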